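/- Let h : ℝⁿ → ℝ be ρ-weakly convex and bounded from below, let λ ∈ (0, ρ⁻¹), and set L := max{λ⁻¹, ρ/(1−λρ)}; then Prox_{λh} is single-valued and the Moreau envelope e_λh is C¹ with L-Lipschitz gradient ∇e_λh(x) = λ⁻¹(x − Prox_{λh}(x)). Let ν ∈ (0,1), τ > 0, and nonnegative sequences (β_k), (γ_k) with β̄ := sup β_k < 1 and δ̄ := sup|β_k − γ_k| < ∞ satisfy max{Lτ, 2Lτδ̄ + (Lτ+1)β̄²} < 1 − ν, and let (x^k) be the inexact-proximal-point-with-momentum (IPPm) iterates: x⁰ = x¹ ∈ ℝⁿ, x^k_in := x^k + β_k(x^k − x^{k−1}), x^k_ex := x^k + γ_k(x^k − x^{k−1}), g^k := λ⁻¹(x^k_ex − p^k) with ‖p^k − Prox_{λh}(x^k_ex)‖ ≤ ν‖p^k − x^k_ex‖, x^{k+1} := x^k_in − τg^k, where x^k_ex ≠ Prox_{λh}(x^k_ex) for all k. Then every accumulation point x̄ of (x^k) satisfies x̄ = Prox_{λh}(x̄), and if additionally e_λh satisfies the PLK condition at such an accumulation point x̄, then the whole sequence (x^k) converges to x̄.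 -/

import Mathlib

open Set Filter

/-- The Polyak–Łojasiewicz–Kurdyka (PLK) condition for `F` at `x₀`. -/
def PLKCondition {n : ℕ} (F : EuclideanSpace ℝ (Fin n) → ℝ)
    (x₀ : EuclideanSpace ℝ (Fin n)) : Prop :=
  ∃ (η : ℝ) (U : Set (EuclideanSpace ℝ (Fin n))) (φ : ℝ → ℝ),
    0 < η ∧ U ∈ nhds x₀ ∧ φ 0 = 0 ∧
    (∀ t ∈ Set.Ico (0:ℝ) η, 0 ≤ φ t) ∧
    ConcaveOn ℝ (Set.Ico 0 η) φ ∧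
    (∀ t ∈ Set.Ioo (0:ℝ) η, HasDerivAt φ (deriv φ t) t) ∧
    ContinuousOn (deriv φ) (Set.Ioo 0 η) ∧
    (∀ t ∈ Set.Ioo (0:ℝ) η, 0 < deriv φ t) ∧
    ∀ x ∈ U, F x₀ < F x → F x < F x₀ + η →
      1 ≤ deriv φ (F x - F x₀) * ‖gradient F x‖

section Moreau

variable {E : Type*} [NormedAddCommGroup E] [InnerProductSpace ℝ E]

open scoped RealInnerProductSpace

/-- The objective of the proximal problem of a weakly convex function grows quadratically around
its minimizer. -/
lemma prox_quadratic_growth {h : E → ℝ} {ρ lam : ℝ}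
    (hweak : ConvexOn ℝ univ (fun x => h x + ρ / 2 * ‖x‖ ^ 2)) (hlam : 0 < lam)
    {u q : E}
    (hq : ∀ y, h q + ‖q - u‖ ^ 2 / (2 * lam) ≤ h y + ‖y - u‖ ^ 2 / (2 * lam)) (y : E) :
    h q + ‖q - u‖ ^ 2 / (2 * lam) + (1 - lam * ρ) / (2 * lam) * ‖y - q‖ ^ 2 ≤
      h y + ‖y - u‖ ^ 2 / (2 * lam) := by
  set A := h y + ‖y - u‖ ^ 2 / (2 * lam) - (h q + ‖q - u‖ ^ 2 / (2 * lam)) with hA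
  set B := (1 - lam * ρ) / (2 * lam) * ‖y - q‖ ^ 2 with hB
  have key : ∀ b ∈ Ioo (0 : ℝ) 1, (1 - b) * B ≤ A := by
    rintro b ⟨hb0, hb1⟩
    have h1 := hweak.2 (mem_univ q) (mem_univ y) (sub_nonneg.2 hb1.le) hb0.le (by ring)
    have h2 := hq ((1 - b) • q + b • y)
    have e1 : ‖(1 - b) • q + b • y‖ ^ 2 =
        (1 - b) * ‖q‖ ^ 2 + b * ‖y‖ ^ 2 - b * (1 - b) * ‖y - q‖ ^ 2 := by
      simp only [← real_inner_self_eq_norm_sq, inner_add_left, inner_add_right, inner_sub_left,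
        inner_sub_right, real_inner_smul_left, real_inner_smul_right, real_inner_comm q y]
      ring
    have e2 : ‖(1 - b) • q + b • y - u‖ ^ 2 =
        (1 - b) * ‖q - u‖ ^ 2 + b * ‖y - u‖ ^ 2 - b * (1 - b) * ‖y - q‖ ^ 2 := by
      simp only [← real_inner_self_eq_norm_sq, inner_add_left, inner_add_right, inner_sub_left,
        inner_sub_right, real_inner_smul_left, real_inner_smul_right, real_inner_comm q y,
        real_inner_comm q u, real_inner_comm y u]
      ring
    simp only [smul_eq_mul] at h1
    rw [e1] at h1
    rw [e2] at h2
    have h3 : b * ((1 - b) * B) ≤ b * A := by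
      have : b * A - b * ((1 - b) * B) =
          (1 - b) * (h q + ρ / 2 * ‖q‖ ^ 2) + b * (h y + ρ / 2 * ‖y‖ ^ 2)
          - ρ / 2 * ((1 - b) * ‖q‖ ^ 2 + b * ‖y‖ ^ 2 - b * (1 - b) * ‖y - q‖ ^ 2)
          + ((1 - b) * ‖q - u‖ ^ 2 + b * ‖y - u‖ ^ 2 - b * (1 - b) * ‖y - q‖ ^ 2) / (2 * lam)
          - (h q + ‖q - u‖ ^ 2 / (2 * lam)) := by
        rw [hA, hB]
        field_simp
        ring
      linarith
    exact le_of_mul_le_mul_left h3 hb0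
  have hlim : Tendsto (fun b : ℝ => (1 - b) * B) (nhdsWithin 0 (Ioi 0)) (nhds B) := by
    have : Tendsto (fun b : ℝ => (1 - b) * B) (nhds 0) (nhds ((1 - 0) * B)) :=
      (by fun_prop : Continuous fun b : ℝ => (1 - b) * B).tendsto 0
    rw [sub_zero, one_mul] at this
    exact this.mono_left nhdsWithin_le_nhds
  have := le_of_tendsto hlim
    (Filter.mem_of_superset (Ioo_mem_nhdsGT one_pos) key)
  linarith

/-- Upper quadratic bound for the Moreau envelope. -/
lemma moreau_le {h env : E → ℝ} {prox : E → E} {lam : ℝ} (hlam : 0 < lam)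
    (hprox : ∀ u y, h (prox u) + ‖prox u - u‖ ^ 2 / (2 * lam) ≤ h y + ‖y - u‖ ^ 2 / (2 * lam))
    (henv : ∀ u, env u = h (prox u) + ‖prox u - u‖ ^ 2 / (2 * lam)) (u v : E) :
    env v ≤ env u + ⟪lam⁻¹ • (u - prox u), v - u⟫ + lam⁻¹ / 2 * ‖v - u‖ ^ 2 := by
  have h1 := hprox v (prox u)
  rw [← henv] at h1
  have e : ‖prox u - v‖ ^ 2 =
      ‖prox u - u‖ ^ 2 + 2 * ⟪u - prox u, v - u⟫ + ‖v - u‖ ^ 2 := by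
    have : prox u - v = -((u - prox u) + (v - u)) := by abel
    rw [this, norm_neg, norm_add_sq_real, norm_sub_rev u (prox u)]
  rw [e] at h1
  rw [henv u, real_inner_smul_left]
  refine h1.trans (le_of_eq ?_)
  field_simp
  ring

/-- Lower quadratic bound for the Moreau envelope of a weakly convex function. -/
lemma le_moreau {h env : E → ℝ} {prox : E → E} {ρ lam : ℝ}
    (hweak : ConvexOn ℝ univ (fun x => h x + ρ / 2 * ‖x‖ ^ 2)) (hlam : 0 < lam)
    (hlamρ : lam * ρ < 1)
    (hprox : ∀ u y, h (prox u) + ‖prox u - u‖ ^ 2 / (2 * lam) ≤ h y + ‖y - u‖ ^ 2 / (2 * lam))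
    (henv : ∀ u, env u = h (prox u) + ‖prox u - u‖ ^ 2 / (2 * lam)) (u v : E) :
    env u + ⟪lam⁻¹ • (u - prox u), v - u⟫ - ρ / (1 - lam * ρ) / 2 * ‖v - u‖ ^ 2 ≤ env v := by
  have h1 := prox_quadratic_growth hweak hlam (hprox u) (prox v)
  rw [← henv] at h1
  have hκ : 0 < 1 - lam * ρ := by linarith
  have e : ‖prox v - u‖ ^ 2 = ‖prox v - v‖ ^ 2 - 2 * ⟪u - prox u, v - u⟫
      + 2 * ⟪prox v - prox u, v - u⟫ - ‖v - u‖ ^ 2 := by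
    simp only [← real_inner_self_eq_norm_sq, inner_sub_left, inner_sub_right,
      real_inner_comm u v, real_inner_comm u (prox v), real_inner_comm v (prox v)]
    ring
  have hsq := sq_nonneg ‖(1 - lam * ρ) • (prox v - prox u) - (v - u)‖
  rw [norm_sub_sq_real, norm_smul, real_inner_smul_left, Real.norm_of_nonneg hκ.le] at hsq
  rw [e] at h1
  rw [henv v, real_inner_smul_left]
  have hpos : 0 < 2 * lam * (1 - lam * ρ) := by positivity
  rw [← sub_nonneg] at h1 ⊢
  have h2 : 0 ≤ (((1 - lam * ρ) * ‖prox v - prox u‖) ^ 2 -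
      2 * ((1 - lam * ρ) * ⟪prox v - prox u, v - u⟫) + ‖v - u‖ ^ 2) / (2 * lam * (1 - lam * ρ)) :=
    div_nonneg hsq hpos.le
  refine (add_nonneg h1 h2).trans (le_of_eq ?_)
  field_simp
  ring

/-- The gradient map of the Moreau envelope is Lipschitz continuous. -/
lemma moreau_gradient_lipschitz {h : E → ℝ} {prox : E → E} {ρ lam : ℝ}
    (hweak : ConvexOn ℝ univ (fun x => h x + ρ / 2 * ‖x‖ ^ 2)) (hlam : 0 < lam)
    (hlamρ : lam * ρ < 1)
    (hprox : ∀ u y, h (prox u) + ‖prox u - u‖ ^ 2 / (2 * lam) ≤ h y + ‖y - u‖ ^ 2 / (2 * lam))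
    (u v : E) :
    ‖lam⁻¹ • (u - prox u) - lam⁻¹ • (v - prox v)‖ ≤
      max lam⁻¹ (ρ / (1 - lam * ρ)) * ‖u - v‖ := by
  have h1 := prox_quadratic_growth hweak hlam (hprox u) (prox v)
  have h2 := prox_quadratic_growth hweak hlam (hprox v) (prox u)
  set κ := 1 - lam * ρ with hκdef
  have hκ : 0 < κ := by linarith
  have hmono : κ * ‖prox u - prox v‖ ^ 2 ≤ ⟪prox u - prox v, u - v⟫ := by
    have e : 2 * ⟪prox u - prox v, u - v⟫ = ‖prox v - u‖ ^ 2 + ‖prox u - v‖ ^ 2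
        - ‖prox u - u‖ ^ 2 - ‖prox v - v‖ ^ 2 := by
      simp only [norm_sub_sq_real, inner_sub_left, inner_sub_right]
      ring
    rw [norm_sub_rev (prox v)] at h1
    have h3 : κ / (2 * lam) * ‖prox u - prox v‖ ^ 2 * 2 ≤
        (2 * ⟪prox u - prox v, u - v⟫) / (2 * lam) := by
      rw [e]
      have : (‖prox v - u‖ ^ 2 + ‖prox u - v‖ ^ 2 - ‖prox u - u‖ ^ 2 - ‖prox v - v‖ ^ 2) /
          (2 * lam) = ‖prox v - u‖ ^ 2 / (2 * lam) + ‖prox u - v‖ ^ 2 / (2 * lam) -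
          ‖prox u - u‖ ^ 2 / (2 * lam) - ‖prox v - v‖ ^ 2 / (2 * lam) := by ring
      rw [this]
      linarith
    rw [le_div_iff₀ (by positivity)] at h3
    have e3 : κ / (2 * lam) * ‖prox u - prox v‖ ^ 2 * 2 * (2 * lam) =
        2 * (κ * ‖prox u - prox v‖ ^ 2) := by field_simp
    linarith
  have e : lam⁻¹ • (u - prox u) - lam⁻¹ • (v - prox v) =
      lam⁻¹ • ((u - v) - (prox u - prox v)) := by
    rw [← smul_sub]
    congr 1
    abel
  rw [e, norm_smul, Real.norm_of_nonneg (inv_nonneg.2 hlam.le)]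
  have hsq := norm_sub_sq_real (u - v) (prox u - prox v)
  rw [real_inner_comm] at hsq
  have hcs := real_inner_le_norm (prox u - prox v) (u - v)
  set z := prox u - prox v
  set w := u - v
  have hw := norm_nonneg w
  have hz := norm_nonneg z
  rcases le_total (1 / 2) κ with hk | hk
  · have h3 : ‖w - z‖ ≤ ‖w‖ := by
      refine le_of_sq_le_sq ?_ hw
      nlinarith [sq_nonneg ‖z‖]
    exact (mul_le_mul_of_nonneg_left h3 (inv_nonneg.2 hlam.le)).trans
      (mul_le_mul_of_nonneg_right (le_max_left _ _) hw)
  · have h4 : κ * ‖z‖ ≤ ‖w‖ := by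
      rcases hz.eq_or_lt with h0 | h0
      · rw [← h0, mul_zero]
        exact hw
      · refine le_of_mul_le_mul_right ?_ h0
        nlinarith
    have h3 : κ * ‖w - z‖ ≤ (1 - κ) * ‖w‖ := by
      refine le_of_sq_le_sq ?_ (mul_nonneg (by linarith) hw)
      have h5 : (κ * ‖z‖) ^ 2 ≤ ‖w‖ ^ 2 := by gcongr
      have h6 : κ ^ 2 * ‖w - z‖ ^ 2 ≤ κ ^ 2 * (‖w‖ ^ 2 + (1 - 2 * κ) * ‖z‖ ^ 2) := by
        gcongr
        linarith
      have h7 := mul_le_mul_of_nonneg_left h5 (by linarith : 0 ≤ 1 - 2 * κ)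
      nlinarith
    refine le_trans ?_ (mul_le_mul_of_nonneg_right (le_max_right _ _) hw)
    have : ρ / κ * ‖w‖ = lam⁻¹ * ((1 - κ) * ‖w‖ / κ) := by
      rw [hκdef]
      field_simp
      ring
    rw [this]
    refine mul_le_mul_of_nonneg_left ?_ (inv_nonneg.2 hlam.le)
    rw [le_div_iff₀ hκ]
    linarith

/-- A two-sided quadratic bound identifies the gradient. -/
lemma hasGradientAt_of_abs_le [CompleteSpace E] {f : E → ℝ} {a u : E} {C : ℝ}
    (hf : ∀ v, |f v - f u - ⟪a, v - u⟫| ≤ C * ‖v - u‖ ^ 2) : HasGradientAt f a u := by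
  rw [hasGradientAt_iff_isLittleO]
  have h1 : (fun v => f v - f u - ⟪a, v - u⟫) =O[nhds u] fun v => ‖v - u‖ ^ 2 := by
    refine Asymptotics.IsBigO.of_bound C (Eventually.of_forall fun v => ?_)
    simpa using hf v
  refine h1.trans_isLittleO ?_
  have h2 : (fun v : E => ‖v - u‖ ^ 2) =o[nhds u] fun v => ‖v - u‖ := by
    have := (Asymptotics.isLittleO_norm_pow_id (E' := E) one_lt_two)
    have h3 : Tendsto (fun v => v - u) (nhds u) (nhds 0) := by
      have : Continuous fun v : E => v - u := by fun_prop
      simpa using this.tendsto u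
    exact (this.comp_tendsto h3).norm_right
  exact h2.of_norm_right

end Moreau

section Descent

variable {E : Type*} [NormedAddCommGroup E] [InnerProductSpace ℝ E]

open scoped RealInnerProductSpace

/-- One step of an inexact gradient method with momentum decreases the Lyapunov function
`2 τ f (x) + c ‖d‖²`, where `d` is the last displacement. -/
lemma momentum_step_descent {f : E → ℝ} {G : E → E} {L ν τ b δ β γ : ℝ}
    (hup : ∀ u v, f v ≤ f u + ⟪G u, v - u⟫ + L / 2 * ‖v - u‖ ^ 2)
    (hlow : ∀ u v, f u + ⟪G u, v - u⟫ - L / 2 * ‖v - u‖ ^ 2 ≤ f v)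
    (hlip : ∀ u v, ‖G u - G v‖ ≤ L * ‖u - v‖)
    (hL : 0 ≤ L) (hν : 0 ≤ ν) (hτ : 0 ≤ τ) (hβ : 0 ≤ β) (hβb : β ≤ b) (hδ : |β - γ| ≤ δ)
    {x d g : E} (hg : ‖g - G (x + γ • d)‖ ≤ ν * ‖g‖) :
    2 * τ * f (x + (β • d - τ • g)) + (1 - ν - L * τ * δ) * ‖β • d - τ • g‖ ^ 2
      + (1 - ν - L * τ) * τ ^ 2 * ‖g‖ ^ 2 ≤
    2 * τ * f x + ((1 + L * τ) * b ^ 2 + L * τ * δ) * ‖d‖ ^ 2 := by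
  set D := β • d - τ • g with hD
  set w := x + β • d with hw
  have h1 := hup w (x + D)
  have h2 := hlow w x
  have e1 : x + D - w = -(τ • g) := by rw [hD, hw]; abel
  have e2 : x - w = -(β • d) := by rw [hw]; abel
  rw [e1, norm_neg, norm_smul, Real.norm_of_nonneg hτ, inner_neg_right] at h1
  rw [e2, norm_neg, norm_smul, Real.norm_of_nonneg hβ, inner_neg_right] at h2
  have h3 : ⟪G w, D⟫ = ⟪G w, β • d⟫ - ⟪G w, τ • g⟫ := by rw [hD, inner_sub_right]
  have h4 : 2 * τ * ⟪g, D⟫ = β ^ 2 * ‖d‖ ^ 2 - τ ^ 2 * ‖g‖ ^ 2 - ‖D‖ ^ 2 := by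
    have e : β • d = τ • g + D := by rw [hD]; abel
    have := norm_add_sq_real (τ • g) D
    rw [← e, norm_smul, norm_smul, Real.norm_of_nonneg hτ, Real.norm_of_nonneg hβ,
      real_inner_smul_left] at this
    linarith
  have h5 : ‖G w - g‖ ≤ L * (δ * ‖d‖) + ν * ‖g‖ := by
    have e : w - (x + γ • d) = (β - γ) • d := by rw [hw, sub_smul]; abel
    have h6 := hlip w (x + γ • d)
    rw [e, norm_smul, Real.norm_eq_abs] at h6
    have h7 : L * (|β - γ| * ‖d‖) ≤ L * (δ * ‖d‖) := by gcongr
    have h8 := norm_sub_le_norm_sub_add_norm_sub (G w) (G (x + γ • d)) g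
    rw [norm_sub_rev (G (x + γ • d)) g] at h8
    linarith
  have h6 : ⟪G w, D⟫ ≤ ⟪g, D⟫ + (L * (δ * ‖d‖) + ν * ‖g‖) * ‖D‖ := by
    have h7 := real_inner_le_norm (G w - g) D
    rw [inner_sub_left] at h7
    have h8 := mul_le_mul_of_nonneg_right h5 (norm_nonneg D)
    linarith
  have hδ0 : 0 ≤ δ := (abs_nonneg _).trans hδ
  have hτ2 := mul_nonneg zero_le_two hτ
  have h9 : 2 * τ * (f (x + D)) ≤ 2 * τ * (f x + ⟪g, D⟫ + (L * (δ * ‖d‖) + ν * ‖g‖) * ‖D‖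
      + L / 2 * (β * ‖d‖) ^ 2 + L / 2 * (τ * ‖g‖) ^ 2) :=
    mul_le_mul_of_nonneg_left (by linarith) hτ2
  have h10 : (1 + L * τ) * (β ^ 2 * ‖d‖ ^ 2) ≤ (1 + L * τ) * (b ^ 2 * ‖d‖ ^ 2) := by gcongr
  have h11 : 0 ≤ ν * (τ * ‖g‖ - ‖D‖) ^ 2 := mul_nonneg hν (sq_nonneg _)
  have h12 : 0 ≤ L * τ * δ * (‖d‖ - ‖D‖) ^ 2 := by positivity
  linarith

/-- Shifting a sequence does not change its cluster points. -/
lemma mapClusterPt_add_iff_nat {X : Type*} [TopologicalSpace X] {y : ℕ → X} {z : X} (m : ℕ) :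
    MapClusterPt z atTop (fun k => y (k + m)) ↔ MapClusterPt z atTop y := by
  have h : map (fun k => y (k + m)) atTop = map y atTop := by
    conv_rhs => rw [← map_add_atTop_eq_nat m, map_map]
    rfl
  rw [MapClusterPt, MapClusterPt, h]

/-- A sequence with a cluster point whose steps are controlled, near that point, by the decrease
of an antitone function that is bounded below, converges. -/
lemma tendsto_of_dist_le_sub {X : Type*} [PseudoMetricSpace X] {y : ℕ → X} {z : X} {U : Set X}
    {s : ℕ → ℝ} (hU : U ∈ nhds z) (hs : Antitone s) (hsb : BddBelow (range s))
    (hd : ∀ k, y k ∈ U → dist (y k) (y (k + 1)) ≤ s k - s (k + 1))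
    (hz : MapClusterPt z atTop y) : Tendsto y atTop (nhds z) := by
  rw [Metric.tendsto_atTop]
  intro ε hε
  obtain ⟨r, hr, hrU⟩ := Metric.mem_nhds_iff.1 hU
  set e := min ε r
  have he : 0 < e := lt_min hε hr
  have hlim := tendsto_atTop_ciInf hs hsb
  have h1 : ∀ᶠ k in atTop, s k < iInf s + e / 2 :=
    hlim.eventually (gt_mem_nhds (by linarith))
  have h2 : ∃ᶠ k in atTop, y k ∈ Metric.ball z (e / 2) :=
    hz.frequently (Metric.ball_mem_nhds z (by linarith))
  obtain ⟨K, hK1, hK2⟩ := (h2.and_eventually h1).exists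
  have hball : ∀ j, dist (y K) (y (K + j)) ≤ s K - s (K + j) →
      dist (y (K + j)) z < e := by
    intro j hj
    have h3 := ciInf_le hsb (K + j)
    have h4 := dist_triangle_left (y (K + j)) z (y K)
    have h5 := Metric.mem_ball.1 hK1
    linarith
  have hind : ∀ j, dist (y K) (y (K + j)) ≤ s K - s (K + j) := by
    intro j
    induction j with
    | zero => simp
    | succ j ih =>
      have h3 := hd (K + j) (hrU ((hball j ih).trans_le (min_le_right _ _)))
      have h4 := dist_triangle (y K) (y (K + j)) (y (K + j + 1))
      rw [← add_assoc]
      linarith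
  refine ⟨K, fun k hk => ?_⟩
  obtain ⟨j, rfl⟩ := Nat.exists_eq_add_of_le hk
  exact (hball j (hind j)).trans_le (min_le_left _ _)

lemma ConcaveOn.deriv_mul_sub_le {φ : ℝ → ℝ} {S : Set ℝ} {φ' s t : ℝ} (hφ : ConcaveOn ℝ S φ)
    (hs : s ∈ S) (ht : t ∈ S) (hst : s ≤ t) (hd : HasDerivAt φ φ' t) :
    φ' * (t - s) ≤ φ t - φ s := by
  rcases hst.eq_or_lt with rfl | hlt
  · simp
  · have := hφ.le_slope_of_hasDerivAt hs ht hlt hd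
    rwa [slope_def_field, le_div_iff₀ (sub_pos.2 hlt)] at this

lemma ConcaveOn.deriv_le_deriv_of_le {φ : ℝ → ℝ} {S : Set ℝ} {φs φt s t : ℝ}
    (hφ : ConcaveOn ℝ S φ) (hs : s ∈ S) (ht : t ∈ S) (hst : s ≤ t) (hds : HasDerivAt φ φs s)
    (hdt : HasDerivAt φ φt t) : φt ≤ φs := by
  rcases hst.eq_or_lt with rfl | hlt
  · exact (hdt.unique hds).le
  · exact (hφ.le_slope_of_hasDerivAt hs ht hlt hdt).trans
      (hφ.slope_le_of_hasDerivAt hs ht hlt hds)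

end Descent

/-- Along a sequence decreasing the Lyapunov function `f + c ‖d‖²` by a multiple of `r²`, the
residual `r` vanishes and the Lyapunov function converges to the value of `f` at any cluster
point. -/
lemma lyapunov_tendsto {E : Type*} [NormedAddCommGroup E] {f : E → ℝ} {y d : ℕ → E} {r : ℕ → ℝ}
    {c a : ℝ} {z : E} (hc : 0 ≤ c) (ha : 0 < a) (hf : BddBelow (range f)) (hfz : ContinuousAt f z)
    (hdesc : ∀ k, f (y (k + 1)) + c * ‖d (k + 1)‖ ^ 2 + a * r k ^ 2 ≤ f (y k) + c * ‖d k‖ ^ 2)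
    (hr : ∀ k, 0 ≤ r k) (hdr : ∀ k, ‖d k‖ ≤ r k) (hz : MapClusterPt z atTop y) :
    Tendsto r atTop (nhds 0) ∧ Antitone (fun k => f (y k) + c * ‖d k‖ ^ 2) ∧
      Tendsto (fun k => f (y k) + c * ‖d k‖ ^ 2) atTop (nhds (f z)) := by
  set V : ℕ → ℝ := fun k => f (y k) + c * ‖d k‖ ^ 2 with hV
  have hanti : Antitone V := by
    refine antitone_nat_of_succ_le fun k => ?_
    have := hdesc k
    have := mul_nonneg ha.le (sq_nonneg (r k))
    simp only [hV]
    linarith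
  have hbdd : BddBelow (range V) := by
    obtain ⟨B, hB⟩ := hf
    refine ⟨B, ?_⟩
    rintro _ ⟨k, rfl⟩
    have h1 := hB (mem_range_self (y k))
    have : 0 ≤ c * ‖d k‖ ^ 2 := by positivity
    simp only [hV]
    linarith
  have hlim := tendsto_atTop_ciInf hanti hbdd
  have hr2 : Tendsto (fun k => r k ^ 2) atTop (nhds 0) := by
    have h1 : Tendsto (fun k => (V k - V (k + 1)) / a) atTop (nhds 0) := by
      have := (hlim.sub (hlim.comp (tendsto_add_atTop_nat 1))).div_const a
      simpa using this
    refine squeeze_zero (fun k => sq_nonneg _) (fun k => ?_) h1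
    rw [le_div_iff₀ ha]
    have := hdesc k
    simp only [hV]
    linarith
  have hr0 : Tendsto r atTop (nhds 0) := by
    have := hr2.sqrt
    simpa [Real.sqrt_sq (hr _)] using this
  refine ⟨hr0, hanti, ?_⟩
  have hd2 : Tendsto (fun k => c * ‖d k‖ ^ 2) atTop (nhds 0) := by
    have h1 : Tendsto (fun k => ‖d k‖) atTop (nhds 0) :=
      squeeze_zero (fun k => norm_nonneg _) hdr hr0
    simpa using (h1.pow 2).const_mul c
  obtain ⟨ψ, hψ, hyψ⟩ := hz.tendsto_subseq
  have h1 : Tendsto (V ∘ ψ) atTop (nhds (f z)) := by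
    have := (hfz.tendsto.comp hyψ).add (hd2.comp hψ.tendsto_atTop)
    rw [add_zero] at this
    exact this
  rwa [tendsto_nhds_unique h1 (hlim.comp hψ.tendsto_atTop)]

/-- A desingularizing function for `f` yields one for the Lyapunov function `f + c ‖d‖²`, and
hence convergence of descent sequences with a cluster point satisfying the PLK condition. -/
lemma PLKCondition.tendsto {n : ℕ} {f : EuclideanSpace ℝ (Fin n) → ℝ}
    {y d : ℕ → EuclideanSpace ℝ (Fin n)} {r : ℕ → ℝ} {c a M : ℝ} {z : EuclideanSpace ℝ (Fin n)}
    (hc : 0 < c) (ha : 0 < a) (hM : 0 < M) (hf : BddBelow (range f)) (hfz : ContinuousAt f z)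
    (hdesc : ∀ k, f (y (k + 1)) + c * ‖d (k + 1)‖ ^ 2 + a * r k ^ 2 ≤ f (y k) + c * ‖d k‖ ^ 2)
    (hr : ∀ k, 0 < r k) (hdr : ∀ k, ‖d k‖ ≤ r k) (hgr : ∀ k, ‖gradient f (y k)‖ ≤ M * r k)
    (hy : ∀ k, dist (y k) (y (k + 1)) ≤ M * r k) (hz : MapClusterPt z atTop y)
    (hPLK : PLKCondition f z) : Tendsto y atTop (nhds z) := by
  obtain ⟨η, U, φ, hη, hU, -, hφ0, hconc, hder, -, hder0, hKL⟩ := hPLK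
  obtain ⟨-, hanti, hlim⟩ := lyapunov_tendsto hc.le ha hf hfz hdesc (fun k => (hr k).le) hdr hz
  set t : ℕ → ℝ := fun k => f (y k) + c * ‖d k‖ ^ 2 - f z with ht
  have hdec : ∀ k, a * r k ^ 2 ≤ t k - t (k + 1) := by
    intro k
    have := hdesc k
    simp only [ht]
    linarith
  have htpos : ∀ k, 0 < t k := by
    intro k
    have h1 := hanti.le_of_tendsto hlim (k + 1)
    have h2 := hdec k
    have h3 : 0 < a * r k ^ 2 := mul_pos ha (pow_pos (hr k) 2)
    simp only [ht] at h2 ⊢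
    linarith
  have htanti : Antitone t := fun i j hij => sub_le_sub_right (hanti hij) _
  have hteta : ∀ᶠ k in atTop, t k < η :=
    hlim.eventually (gt_mem_nhds (by linarith : f z < f z + η)) |>.mono fun k hk => by
      simp only [ht]
      linarith
  obtain ⟨K, hK⟩ := eventually_atTop.1 hteta
  set C := 2 * √(2 * c) with hC
  set Ψ : ℝ → ℝ := fun u => 2 * φ (u / 2) + C * √u with hΨ
  have hΨsub : ∀ u v, 0 < u → u ≤ v → v < η →
      (deriv φ (v / 2) + C / (2 * √v)) * (v - u) ≤ Ψ v - Ψ u := by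
    intro u v hu huv hv
    have hv0 := hu.trans_le huv
    have h1 := hconc.deriv_mul_sub_le (s := u / 2) (t := v / 2) ⟨by linarith, by linarith⟩
      ⟨by linarith, by linarith⟩ (by linarith) (hder _ ⟨by linarith, by linarith⟩)
    have h2 : 1 / (2 * √v) * (v - u) ≤ √v - √u :=
      Real.strictConcaveOn_sqrt.concaveOn.deriv_mul_sub_le (mem_Ici.2 hu.le)
        (mem_Ici.2 hv0.le) huv (Real.hasDerivAt_sqrt hv0.ne')
    have h3 := mul_le_mul_of_nonneg_left h2 (by positivity : 0 ≤ C)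
    have h4 : (deriv φ (v / 2) + C / (2 * √v)) * (v - u) =
        2 * (deriv φ (v / 2) * (v / 2 - u / 2)) + C * (1 / (2 * √v) * (v - u)) := by ring
    simp only [hΨ]
    rw [h4]
    linarith
  have hΨkl : ∀ k, K ≤ k → y k ∈ U →
      1 ≤ (deriv φ (t k / 2) + C / (2 * √(t k))) * ((M + 1) * r k) := by
    intro k hk hyU
    have htk := htpos k
    have htη := hK k hk
    have hφk := hder0 (t k / 2) ⟨by linarith, by linarith⟩
    have hCk : 0 ≤ C / (2 * √(t k)) := by positivity
    rcases le_total (t k / 2) (f (y k) - f z) with hcase | hcase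
    · have hle : f (y k) - f z ≤ t k := by
        have : 0 ≤ c * ‖d k‖ ^ 2 := by positivity
        simp only [ht]
        linarith
      have h1 := hKL (y k) hyU (by linarith) (by linarith)
      have h2 : deriv φ (f (y k) - f z) ≤ deriv φ (t k / 2) :=
        hconc.deriv_le_deriv_of_le ⟨by linarith, by linarith⟩ ⟨by linarith, by linarith⟩ hcase
          (hder _ ⟨by linarith, by linarith⟩) (hder _ ⟨by linarith, by linarith⟩)
      refine h1.trans (mul_le_mul (by linarith) ?_ (norm_nonneg _) (by linarith))
      have := hgr k
      have := hr k
      linarith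
    · have h1 : t k / 2 ≤ c * ‖d k‖ ^ 2 := by
        have : t k = f (y k) + c * ‖d k‖ ^ 2 - f z := rfl
        linarith
      have h2 : √(t k) ≤ √(2 * c) * ‖d k‖ := by
        rw [← Real.sqrt_sq (norm_nonneg (d k)), ← Real.sqrt_mul (by positivity)]
        exact Real.sqrt_le_sqrt (by linarith)
      have h3 : 1 ≤ C / (2 * √(t k)) * ‖d k‖ := by
        have := Real.sqrt_pos.2 htk
        rw [hC, div_mul_eq_mul_div, le_div_iff₀ (by positivity)]
        linarith
      refine h3.trans (mul_le_mul (by linarith) ?_ (norm_nonneg _) (by linarith))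
      have := hdr k
      have := mul_pos hM (hr k)
      linarith
  have hstep : ∀ k, K ≤ k → y k ∈ U →
      dist (y k) (y (k + 1)) ≤ M * (M + 1) / a * (Ψ (t k) - Ψ (t (k + 1))) := by
    intro k hk hyU
    have h1 := hΨsub _ _ (htpos (k + 1)) (htanti k.le_succ) (hK k hk)
    have h2 := hΨkl k hk hyU
    set P := deriv φ (t k / 2) + C / (2 * √(t k))
    have hrk := hr k
    have hP : 0 < P := by
      by_contra hcon
      have := mul_nonpos_of_nonpos_of_nonneg (not_lt.1 hcon)
        (by positivity : 0 ≤ (M + 1) * r k)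
      linarith
    have h3 := mul_le_mul_of_nonneg_left (hdec k) hP.le
    have h4 : a * r k ≤ P * ((M + 1) * r k) * (a * r k) :=
      le_mul_of_one_le_left (by positivity) h2
    have h5 : a * r k ≤ (M + 1) * (Ψ (t k) - Ψ (t (k + 1))) :=
      calc a * r k ≤ (M + 1) * (P * (a * r k ^ 2)) := by linarith
        _ ≤ _ := mul_le_mul_of_nonneg_left (h3.trans h1) (by linarith)
    refine (hy k).trans ?_
    rw [div_mul_eq_mul_div, le_div_iff₀ ha]
    nlinarith
  rw [← tendsto_add_atTop_iff_nat K]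
  refine tendsto_of_dist_le_sub (s := fun k => M * (M + 1) / a * Ψ (t (k + K))) hU ?_ ?_ ?_ ?_
  · refine antitone_nat_of_succ_le fun k => mul_le_mul_of_nonneg_left ?_ (by positivity)
    have h1 := hΨsub _ _ (htpos (k + 1 + K)) (htanti (by omega : k + K ≤ k + 1 + K))
      (hK (k + K) (by omega))
    have h2 : 0 ≤ t (k + K) - t (k + 1 + K) := sub_nonneg.2 (htanti (by omega))
    have htk := htpos (k + K)
    have htη := hK (k + K) (by omega)
    have hφk := hder0 (t (k + K) / 2) ⟨by linarith, by linarith⟩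
    have h3 : 0 ≤ deriv φ (t (k + K) / 2) + C / (2 * √(t (k + K))) :=
      add_nonneg hφk.le (by positivity)
    have := mul_nonneg h3 h2
    linarith
  · refine ⟨0, ?_⟩
    rintro _ ⟨k, rfl⟩
    have htk := htpos (k + K)
    have htη := hK (k + K) (by omega)
    have := hφ0 (t (k + K) / 2) ⟨by linarith, by linarith⟩
    simp only [hΨ]
    positivity
  · intro k hk
    have := hstep (k + K) (by omega) hk
    rw [← mul_sub, add_right_comm k 1 K]
    exact this
  · exact (mapClusterPt_add_iff_nat K).2 hz

/-- Global convergence of the inexact proximal point method with momentum (IPPm) for a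
`ρ`-weakly convex function `h` bounded from below.  Here `prox` is a selection of
minimizers of `y ↦ h y + ‖y - u‖²/(2λ)` (so `prox = Prox_{λh}`) and
`env = e_λ h` is the Moreau envelope.  The conclusions: `Prox_{λh}` is single-valued,
`e_λ h` is `C¹` with `L`-Lipschitz gradient `∇e_λh(u) = λ⁻¹(u - Prox_{λh}(u))`,
every accumulation point `xb` of the IPPm iterates is a fixed point of `Prox_{λh}`,
and under the PLK condition for `e_λ h` at `xb` the whole sequence converges to `xb`. -/
theorem IPPm_global_convergence {n : ℕ}
    (h : EuclideanSpace ℝ (Fin n) → ℝ)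
    (ρ : ℝ) (hρ : 0 ≤ ρ)
    (hweak : ConvexOn ℝ Set.univ (fun x => h x + ρ/2 * ‖x‖^2))
    (hbdd : BddBelow (Set.range h))
    (lam : ℝ) (hlam : 0 < lam) (hlamρ : lam * ρ < 1)
    (L : ℝ) (hLdef : L = max lam⁻¹ (ρ / (1 - lam * ρ)))
    (prox : EuclideanSpace ℝ (Fin n) → EuclideanSpace ℝ (Fin n))
    (hprox : ∀ u y : EuclideanSpace ℝ (Fin n),
      h (prox u) + ‖prox u - u‖^2 / (2*lam) ≤ h y + ‖y - u‖^2 / (2*lam))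
    (env : EuclideanSpace ℝ (Fin n) → ℝ)
    (henv : ∀ u, env u = h (prox u) + ‖prox u - u‖^2 / (2*lam))
    (ν τ βbar δbar : ℝ) (hν : ν ∈ Set.Ioo (0:ℝ) 1) (hτ : 0 < τ)
    (hparam : max (L*τ) (2*L*τ*δbar + (L*τ+1)*βbar^2) < 1 - ν)
    (β γ : ℕ → ℝ) (hβnn : ∀ k, 0 ≤ β k) (hγnn : ∀ k, 0 ≤ γ k)
    (hβbar : ∀ k, β k ≤ βbar) (hβbar1 : βbar < 1)
    (hδbar : ∀ k, |β k - γ k| ≤ δbar)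
    (x xin xex g p : ℕ → EuclideanSpace ℝ (Fin n))
    (hx01 : x 0 = x 1)
    (hxin : ∀ k, 1 ≤ k → xin k = x k + β k • (x k - x (k-1)))
    (hxex : ∀ k, 1 ≤ k → xex k = x k + γ k • (x k - x (k-1)))
    (hp : ∀ k, 1 ≤ k → ‖p k - prox (xex k)‖ ≤ ν * ‖p k - xex k‖)
    (hgk : ∀ k, 1 ≤ k → g k = lam⁻¹ • (xex k - p k))
    (hupd : ∀ k, 1 ≤ k → x (k+1) = xin k - τ • g k)
    (hne : ∀ k, 1 ≤ k → xex k ≠ prox (xex k)) :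
    -- single-valuedness of the proximal mapping
    (∀ u y : EuclideanSpace ℝ (Fin n),
      (∀ w, h y + ‖y - u‖^2 / (2*lam) ≤ h w + ‖w - u‖^2 / (2*lam)) → y = prox u) ∧
    -- smoothness of the Moreau envelope with the gradient formula
    (∀ u, HasGradientAt env (lam⁻¹ • (u - prox u)) u) ∧
    -- Lipschitz continuity of the gradient of the Moreau envelope
    (∀ u v, ‖gradient env u - gradient env v‖ ≤ L * ‖u - v‖) ∧
    -- convergence properties of the IPPm iterates
    ∀ xb : EuclideanSpace ℝ (Fin n), MapClusterPt xb atTop x →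
      xb = prox xb ∧
      (PLKCondition env xb → Tendsto x atTop (nhds xb)) := by
  have hκ : 0 < 1 - lam * ρ := by linarith
  have hL1 : lam⁻¹ ≤ L := hLdef ▸ le_max_left _ _
  have hL2 : ρ / (1 - lam * ρ) ≤ L := hLdef ▸ le_max_right _ _
  have hL0 : 0 < L := (inv_pos.2 hlam).trans_le hL1
  set G : EuclideanSpace ℝ (Fin n) → EuclideanSpace ℝ (Fin n) :=
    fun u => lam⁻¹ • (u - prox u) with hG
  have hup : ∀ u v, env v ≤ env u + inner ℝ (G u) (v - u) + L / 2 * ‖v - u‖ ^ 2 := by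
    intro u v
    refine (moreau_le hlam hprox henv u v).trans ?_
    gcongr
  have hlow : ∀ u v, env u + inner ℝ (G u) (v - u) - L / 2 * ‖v - u‖ ^ 2 ≤ env v := by
    intro u v
    refine le_trans ?_ (le_moreau hweak hlam hlamρ hprox henv u v)
    gcongr
  have hlip : ∀ u v, ‖G u - G v‖ ≤ L * ‖u - v‖ := by
    rw [hLdef]
    exact moreau_gradient_lipschitz hweak hlam hlamρ hprox
  have hgrad : ∀ u, HasGradientAt env (G u) u := fun u =>
    hasGradientAt_of_abs_le (C := L / 2) fun v => by
      have := hup u v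
      have := hlow u v
      rw [abs_le]
      constructor <;> linarith
  have hgradeq : ∀ u, gradient env u = G u := fun u => (hgrad u).gradient
  refine ⟨fun u y hy => ?_, hgrad, fun u v => by rw [hgradeq, hgradeq]; exact hlip u v, ?_⟩
  · have h1 := prox_quadratic_growth hweak hlam (hprox u) y
    have h2 := hy (prox u)
    have h3 : (1 - lam * ρ) / (2 * lam) * ‖y - prox u‖ ^ 2 ≤ 0 := by linarith
    have h4 : 0 < (1 - lam * ρ) / (2 * lam) := by positivity
    have h5 : ‖y - prox u‖ ^ 2 = 0 :=
      le_antisymm (nonpos_of_mul_nonpos_right h3 h4) (sq_nonneg _)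
    exact sub_eq_zero.1 (norm_eq_zero.1 (pow_eq_zero_iff two_ne_zero |>.1 h5))
  intro xb hxb
  obtain ⟨hp1, hp2⟩ := max_lt_iff.1 hparam
  have hβbar0 : 0 ≤ βbar := (hβnn 0).trans (hβbar 0)
  have hδ0 : 0 ≤ δbar := (abs_nonneg _).trans (hδbar 0)
  set cd := (1 + L * τ) * βbar ^ 2 + L * τ * δbar with hcd
  set cD := 1 - ν - L * τ * δbar with hcD
  set cg := (1 - ν - L * τ) * τ ^ 2 with hcg
  have hcd0 : 0 ≤ cd := by positivity
  have hcdD : cd < cD := by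
    rw [hcd, hcD]
    linarith
  have hcg0 : 0 < cg := mul_pos (by linarith) (by positivity)
  set y : ℕ → EuclideanSpace ℝ (Fin n) := fun k => x (k + 1) with hy
  set d : ℕ → EuclideanSpace ℝ (Fin n) := fun k => x (k + 1) - x k with hd
  set r : ℕ → ℝ := fun k => ‖d k‖ + ‖g (k + 1)‖ with hr
  have hginex : ∀ k, ‖g (k + 1) - G (y k + γ (k + 1) • d k)‖ ≤ ν * ‖g (k + 1)‖ := by
    intro k
    have hk := hp (k + 1) (by omega)
    have h1 : y k + γ (k + 1) • d k = xex (k + 1) := (hxex (k + 1) (by omega)).symm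
    have h2 : g (k + 1) - G (xex (k + 1)) = -(lam⁻¹ • (p (k + 1) - prox (xex (k + 1)))) := by
      rw [hgk (k + 1) (by omega), hG, ← smul_sub, ← smul_neg]
      congr 1
      abel
    have hlam' := inv_nonneg.2 hlam.le
    rw [h1, h2, hgk (k + 1) (by omega), norm_neg, norm_smul, norm_smul,
      Real.norm_of_nonneg hlam', norm_sub_rev (xex (k + 1))]
    calc _ ≤ lam⁻¹ * (ν * ‖p (k + 1) - xex (k + 1)‖) := mul_le_mul_of_nonneg_left hk hlam'
      _ = _ := by ring
  have hstep : ∀ k, y (k + 1) = y k + (β (k + 1) • d k - τ • g (k + 1)) := by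
    intro k
    have h1 := hupd (k + 1) (by omega)
    rw [hxin (k + 1) (by omega)] at h1
    simp only [hy, hd]
    rw [h1, add_tsub_cancel_right, add_sub_assoc]
  have hdstep : ∀ k, d (k + 1) = β (k + 1) • d k - τ • g (k + 1) := by
    intro k
    have : d (k + 1) = y (k + 1) - y k := rfl
    rw [this, hstep, add_sub_cancel_left]
  have hgpos : ∀ k, 0 < ‖g (k + 1)‖ := by
    intro k
    rw [norm_pos_iff]
    intro h0
    have h1 := hgk (k + 1) (by omega)
    rw [h0, eq_comm, smul_eq_zero, or_iff_right (inv_ne_zero hlam.ne'), sub_eq_zero] at h1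
    have h2 := hp (k + 1) (by omega)
    rw [← h1, sub_self, norm_zero, mul_zero] at h2
    exact hne (k + 1) (by omega) (sub_eq_zero.1 (norm_le_zero_iff.1 h2))
  set c := (cd + cD) / 2 / (2 * τ) with hc
  set a := min ((cD - cd) / 2) cg / 2 / (2 * τ) with ha
  have hmin : 0 < min ((cD - cd) / 2) cg := lt_min (by linarith) hcg0
  have hc0 : 0 < c := div_pos (by linarith) (by positivity)
  have ha0 : 0 < a := by positivity
  have hdesc : ∀ k, env (y (k + 1)) + c * ‖d (k + 1)‖ ^ 2 + a * r k ^ 2 ≤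
      env (y k) + c * ‖d k‖ ^ 2 := by
    intro k
    have h1 := momentum_step_descent hup hlow hlip hL0.le hν.1.le hτ.le (hβnn (k + 1))
      (hβbar (k + 1)) (hδbar (k + 1)) (hginex k)
    rw [← hstep, ← hdstep, ← hcd, ← hcD, ← hcg] at h1
    have h2 : min ((cD - cd) / 2) cg / 2 * r k ^ 2 ≤
        (cD - cd) / 2 * ‖d k‖ ^ 2 + cg * ‖g (k + 1)‖ ^ 2 := by
      have h3 : r k ^ 2 ≤ 2 * (‖d k‖ ^ 2 + ‖g (k + 1)‖ ^ 2) := add_sq_le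
      have h4 := mul_le_mul_of_nonneg_left h3 hmin.le
      have h5 := mul_le_mul_of_nonneg_right (min_le_left ((cD - cd) / 2) cg)
        (sq_nonneg ‖d k‖)
      have h6 := mul_le_mul_of_nonneg_right (min_le_right ((cD - cd) / 2) cg)
        (sq_nonneg ‖g (k + 1)‖)
      linarith
    have h3 : 0 ≤ (cD - cd) / 2 * ‖d (k + 1)‖ ^ 2 :=
      mul_nonneg (by linarith) (sq_nonneg _)
    have h4 : c * (2 * τ) = (cd + cD) / 2 := by rw [hc]; field_simp
    have h5 : a * (2 * τ) = min ((cD - cd) / 2) cg / 2 := by rw [ha]; field_simp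
    refine le_of_mul_le_mul_right ?_ (by positivity : 0 < 2 * τ)
    calc _ = 2 * τ * env (y (k + 1)) + c * (2 * τ) * ‖d (k + 1)‖ ^ 2
            + a * (2 * τ) * r k ^ 2 := by ring
      _ ≤ 2 * τ * env (y k) + c * (2 * τ) * ‖d k‖ ^ 2 := by
        rw [h4, h5]
        linarith
      _ = _ := by ring
  have hrpos : ∀ k, 0 < r k := fun k => add_pos_of_nonneg_of_pos (norm_nonneg _) (hgpos k)
  have hdr : ∀ k, ‖d k‖ ≤ r k := fun k => le_add_of_nonneg_right (norm_nonneg _)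
  have hgr' : ∀ k, ‖g (k + 1)‖ ≤ r k := fun k => le_add_of_nonneg_left (norm_nonneg _)
  have hν0 := hν.1
  have hγb : ∀ k, γ k ≤ βbar + δbar := by
    intro k
    have := (abs_le.1 (hδbar k)).1
    have := hβbar k
    linarith
  set M := L * (βbar + δbar) + 1 + ν + τ + βbar with hM
  have hM0 : 0 < M := by positivity
  have hGr : ∀ k, ‖G (y k)‖ ≤ M * r k := by
    intro k
    have h1 := hlip (y k) (y k + γ (k + 1) • d k)
    rw [sub_add_cancel_left, norm_neg, norm_smul, Real.norm_of_nonneg (hγnn _)] at h1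
    have h2 : L * (γ (k + 1) * ‖d k‖) ≤ L * ((βbar + δbar) * r k) := by
      gcongr
      exacts [hγb _, hdr k]
    have h3 := norm_le_norm_add_norm_sub' (G (y k)) (G (y k + γ (k + 1) • d k))
    have h4 := norm_le_norm_add_norm_sub (g (k + 1)) (G (y k + γ (k + 1) • d k))
    have h5 := hginex k
    have h6 := mul_le_mul_of_nonneg_left (hgr' k) hν0.le
    have h7 := hgr' k
    have h8 : 0 ≤ (τ + βbar) * r k := mul_nonneg (by positivity) (hrpos k).le
    linarith
  have hyr : ∀ k, dist (y k) (y (k + 1)) ≤ M * r k := by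
    intro k
    rw [hstep, dist_self_add_right]
    have h1 := norm_sub_le (β (k + 1) • d k) (τ • g (k + 1))
    rw [norm_smul, norm_smul, Real.norm_of_nonneg (hβnn _), Real.norm_of_nonneg hτ.le] at h1
    have h2 := mul_le_mul (hβbar (k + 1)) (hdr k) (norm_nonneg _) hβbar0
    have h3 := mul_le_mul_of_nonneg_left (hgr' k) hτ.le
    have h4 : 0 ≤ (L * (βbar + δbar) + 1 + ν) * r k := mul_nonneg (by positivity) (hrpos k).le
    linarith
  have henvb : BddBelow (range env) := by
    obtain ⟨B, hB⟩ := hbdd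
    refine ⟨B, ?_⟩
    rintro _ ⟨u, rfl⟩
    rw [henv]
    exact (hB (mem_range_self (prox u))).trans (le_add_of_nonneg_right (by positivity))
  have hxby : MapClusterPt xb atTop y := (mapClusterPt_add_iff_nat 1).2 hxb
  have hcont : ContinuousAt env xb := (hgrad xb).continuousAt
  refine ⟨?_, fun hPLK => ?_⟩
  · have hr0 := (lyapunov_tendsto hc0.le ha0 henvb hcont hdesc (fun k => (hrpos k).le) hdr
      hxby).1
    have hGy : Tendsto (fun k => G (y k)) atTop (nhds 0) :=
      squeeze_zero_norm hGr (by simpa using hr0.const_mul M)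
    have hGc : Continuous G := (LipschitzWith.of_dist_le_mul (K := ⟨L, hL0.le⟩) fun u v => by
      rw [dist_eq_norm, dist_eq_norm]
      exact hlip u v).continuous
    obtain ⟨ψ, hψ, hyψ⟩ := hxby.tendsto_subseq
    have h0 : G xb = 0 := tendsto_nhds_unique ((hGc.tendsto xb).comp hyψ)
      (hGy.comp hψ.tendsto_atTop)
    rw [hG, smul_eq_zero, or_iff_right (inv_ne_zero hlam.ne'), sub_eq_zero] at h0
    exact h0
  · rw [← tendsto_add_atTop_iff_nat 1]
    exact hPLK.tendsto hc0 ha0 hM0 henvb hcont hdesc hrpos hdr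
      (fun k => by rw [hgradeq]; exact hGr k) hyr hxby
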